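/- arXiv:0812.3667 — 4 statements merged into one kernel-verified Lean document; each statement's English description precedes it below -/
import Mathlib

section
/- Let ρ be a bipartite state on A⊗B (dimensions dA, dB) admitting a symmetric extension, and let Λ be a 1-LOCC operation given by finite families of matrices A_i (dA×dA) and B_{ij} (dB×dB) with ∑_i A_iᴴA_i ≤ I (in the Loewner order) and ∑_j B_{ij}ᴴB_{ij} = I for every i, acting as Λ(ρ) = ∑_{i,j} (A_i ⊗ B_{ij}) ρ (A_i ⊗ B_{ij})ᴴ. Then there exists a positive semidefinite matrix σ indexed by (Fin dA × Fin dB × Fin dB) which is invariant under swapping the two B factors (σ (a,b₁,b₂) (a',b₁',b₂') = σ (a,b₂,b₁) (a',b₂',b₁')) and whose partial trace over the third tensor factor equals Λ(ρ); in particular, if Λ(ρ) has nonzero trace then the normalized state Λ(ρ)/tr(Λ(ρ)) admits a symmetric extension. -/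
open Matrix Kronecker ComplexOrder

noncomputable section

/-- `σ` is a symmetric extension of the bipartite state `ρ`:
`σ` is PSD, has trace 1, its partial trace over the third factor is `ρ`,
and it is invariant under swapping the two `B` factors. -/
def IsSymExt {A B : Type*} [Fintype A] [DecidableEq A] [Fintype B] [DecidableEq B]
    (ρ : Matrix (A × B) (A × B) ℂ)
    (σ : Matrix (A × B × B) (A × B × B) ℂ) : Prop :=
  σ.PosSemidef ∧ σ.trace = 1 ∧
  (∀ a a' b b', ∑ c, σ (a, b, c) (a', b', c) = ρ (a, b) (a', b')) ∧
  (∀ a b₁ b₂ a' b₁' b₂', σ (a, b₁, b₂) (a', b₁', b₂') = σ (a, b₂, b₁) (a', b₂', b₁'))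

/-- The reduced state on the second factor. -/
def reduceB {A B : Type*} [Fintype A] (ρ : Matrix (A × B) (A × B) ℂ) : Matrix B B ℂ :=
  fun b b' => ∑ a, ρ (a, b) (a, b')

/-- The multiset of nonzero eigenvalues (with algebraic multiplicity). -/
def nonzeroSpec {n : Type*} [Fintype n] [DecidableEq n] (M : Matrix n n ℂ) : Multiset ℂ :=
  M.charpoly.roots.filter (· ≠ 0)

/-- The largest (real) eigenvalue of a matrix. -/
def lamMax {n : Type*} [Fintype n] [DecidableEq n] (M : Matrix n n ℂ) : ℝ :=
  sSup {x : ℝ | (x : ℂ) ∈ spectrum ℂ M}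

/-- `ρ` admits a pure (rank-one) symmetric extension. -/
def PureExt {A B : Type*} [Fintype A] [DecidableEq A] [Fintype B] [DecidableEq B]
    (ρ : Matrix (A × B) (A × B) ℂ) : Prop :=
  ∃ σ : Matrix (A × B × B) (A × B × B) ℂ, IsSymExt ρ σ ∧ σ.rank = 1

section PartialTrace

variable {A B C : Type*}

/-- The partial trace over the third factor. -/
def traceThird [Fintype C] (σ : Matrix (A × B × C) (A × B × C) ℂ) : Matrix (A × B) (A × B) ℂ :=
  fun p q => ∑ c, σ (p.1, p.2, c) (q.1, q.2, c)

theorem trace_traceThird [Fintype A] [Fintype B] [Fintype C]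
    (σ : Matrix (A × B × C) (A × B × C) ℂ) :
    (traceThird σ).trace = σ.trace := by
  simp only [Matrix.trace, Matrix.diag, traceThird, Fintype.sum_prod_type]

theorem traceThird_sum [Fintype C] {ι : Type*} (s : Finset ι)
    (σ : ι → Matrix (A × B × C) (A × B × C) ℂ) :
    traceThird (∑ i ∈ s, σ i) = ∑ i ∈ s, traceThird (σ i) := by
  ext p q
  simp only [traceThird, Matrix.sum_apply]
  exact Finset.sum_comm

/-- The block of `σ` at position `(z, z')` of the third factor. -/
def blockThird (σ : Matrix (A × B × C) (A × B × C) ℂ) (z z' : C) :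
    Matrix (A × B) (A × B) ℂ :=
  fun p q => σ (p.1, p.2, z) (q.1, q.2, z')

variable [Fintype A] [Fintype B]

theorem blockThird_kronecker_conj [Fintype C] (M : Matrix A A ℂ)
    (N : Matrix B B ℂ) (L : Matrix C C ℂ)
    (σ : Matrix (A × B × C) (A × B × C) ℂ) (c c' : C) :
    blockThird ((M ⊗ₖ (N ⊗ₖ L)) * σ * (M ⊗ₖ (N ⊗ₖ L))ᴴ) c c' =
      ∑ z, ∑ z', (L c z * star (L c' z')) •
        ((M ⊗ₖ N) * blockThird σ z z' * (M ⊗ₖ N)ᴴ) := by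
  let e : (A × B) × C ≃ A × B × C := Equiv.prodAssoc A B C
  ext ⟨a, b⟩ ⟨a', b'⟩
  simp only [blockThird, Matrix.sum_apply, Matrix.smul_apply, smul_eq_mul, Matrix.mul_apply,
    Finset.sum_mul, Finset.mul_sum, ← e.sum_comp, Fintype.sum_prod_type_right (α₂ := C)]
  refine (Finset.sum_congr rfl fun z' _ => Finset.sum_comm).trans (Finset.sum_comm.trans ?_)
  refine Finset.sum_congr rfl fun z _ => Finset.sum_congr rfl fun z' _ =>
    Finset.sum_congr rfl fun r' _ => Finset.sum_congr rfl fun r _ => ?_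
  simp only [e, Equiv.prodAssoc_apply, Matrix.conjTranspose_apply, Matrix.kroneckerMap_apply,
    star_mul']
  ring

/-- Summing a complete family of Kraus operators over the traced-out factor leaves the
partial trace unaffected. -/
theorem sum_traceThird_kronecker_conj [Fintype C] [DecidableEq C] {ι : Type*} [Fintype ι]
    (M : Matrix A A ℂ) (N : Matrix B B ℂ) (L : ι → Matrix C C ℂ)
    (hL : ∑ l, (L l)ᴴ * L l = 1) (σ : Matrix (A × B × C) (A × B × C) ℂ) :
    ∑ l, traceThird ((M ⊗ₖ (N ⊗ₖ L l)) * σ * (M ⊗ₖ (N ⊗ₖ L l))ᴴ) =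
      (M ⊗ₖ N) * traceThird σ * (M ⊗ₖ N)ᴴ := by
  have hblock (τ : Matrix (A × B × C) (A × B × C) ℂ) :
      traceThird τ = ∑ c, blockThird τ c c := by
    ext p q
    simp only [traceThird, blockThird, Matrix.sum_apply]
  have hδ (z z' : C) : ∑ l, ∑ c, L l c z * star (L l c z') = if z' = z then 1 else 0 := by
    rw [← Matrix.one_apply, ← hL]
    simp only [Matrix.sum_apply, Matrix.mul_apply, Matrix.conjTranspose_apply, mul_comm]
  calc
    _ = ∑ z, ∑ z', (∑ l, ∑ c, L l c z * star (L l c z')) •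
          ((M ⊗ₖ N) * blockThird σ z z' * (M ⊗ₖ N)ᴴ) := by
      simp only [hblock, blockThird_kronecker_conj, Finset.sum_smul]
      refine (Finset.sum_congr rfl fun l _ => Finset.sum_comm.trans
        (Finset.sum_congr rfl fun z _ => Finset.sum_comm)).trans (Finset.sum_comm.trans ?_)
      exact Finset.sum_congr rfl fun z _ => Finset.sum_comm
    _ = _ := by
      simp only [hδ, ite_smul, one_smul, zero_smul, Finset.sum_ite_eq', Finset.mem_univ,
        if_true, hblock, Finset.mul_sum, Finset.sum_mul]

/-- Swapping the last two factors of a swap-invariant matrix conjugated by `M ⊗ N ⊗ L`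
exchanges the roles of `N` and `L`. -/
theorem swap_kronecker_conj (M : Matrix A A ℂ) (N L : Matrix B B ℂ)
    (σ : Matrix (A × B × B) (A × B × B) ℂ)
    (hσ : ∀ a b₁ b₂ a' b₁' b₂', σ (a, b₁, b₂) (a', b₁', b₂') = σ (a, b₂, b₁) (a', b₂', b₁'))
    (a : A) (b₁ b₂ : B) (a' : A) (b₁' b₂' : B) :
    ((M ⊗ₖ (N ⊗ₖ L)) * σ * (M ⊗ₖ (N ⊗ₖ L))ᴴ) (a, b₁, b₂) (a', b₁', b₂') =
      ((M ⊗ₖ (L ⊗ₖ N)) * σ * (M ⊗ₖ (L ⊗ₖ N))ᴴ) (a, b₂, b₁) (a', b₂', b₁') := by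
  let e : A × B × B ≃ A × B × B := (Equiv.refl A).prodCongr (Equiv.prodComm B B)
  have hσe : σ.submatrix e e = σ := by
    ext ⟨x, y, z⟩ ⟨x', y', z'⟩
    exact (hσ x y z x' y' z').symm
  have hK : (M ⊗ₖ (L ⊗ₖ N)).submatrix e e = M ⊗ₖ (N ⊗ₖ L) := by
    ext ⟨x, y, z⟩ ⟨x', y', z'⟩
    simp [e, mul_comm (L _ _)]
  have h : ((M ⊗ₖ (L ⊗ₖ N)) * σ * (M ⊗ₖ (L ⊗ₖ N))ᴴ).submatrix e e =
      (M ⊗ₖ (N ⊗ₖ L)) * σ * (M ⊗ₖ (N ⊗ₖ L))ᴴ := by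
    rw [← Matrix.submatrix_mul_equiv _ _ e e e, ← Matrix.submatrix_mul_equiv _ _ e e e,
      ← Matrix.conjTranspose_submatrix, hK, hσe]
  rw [← h]
  rfl

end PartialTrace

/-- 1-LOCC operations preserve symmetric extendibility. -/
theorem stmt_0 (dA dB m k : ℕ)
    (ρ : Matrix (Fin dA × Fin dB) (Fin dA × Fin dB) ℂ)
    (hρ : ρ.PosSemidef) (hρtr : ρ.trace = 1)
    (hext : ∃ σ, IsSymExt ρ σ)
    (Amat : Fin m → Matrix (Fin dA) (Fin dA) ℂ)
    (Bmat : Fin m → Fin k → Matrix (Fin dB) (Fin dB) ℂ)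
    (hA : ((1 : Matrix (Fin dA) (Fin dA) ℂ) - ∑ i, (Amat i)ᴴ * Amat i).PosSemidef)
    (hB : ∀ i, ∑ j, (Bmat i j)ᴴ * Bmat i j = 1)
    (Λρ : Matrix (Fin dA × Fin dB) (Fin dA × Fin dB) ℂ)
    (hΛρ : Λρ = ∑ i, ∑ j, (Amat i ⊗ₖ Bmat i j) * ρ * (Amat i ⊗ₖ Bmat i j)ᴴ) :
    (∃ σ : Matrix (Fin dA × Fin dB × Fin dB) (Fin dA × Fin dB × Fin dB) ℂ,
      σ.PosSemidef ∧
      (∀ a b₁ b₂ a' b₁' b₂', σ (a, b₁, b₂) (a', b₁', b₂') = σ (a, b₂, b₁) (a', b₂', b₁')) ∧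
      (∀ a a' b b', ∑ c, σ (a, b, c) (a', b', c) = Λρ (a, b) (a', b'))) ∧
    (Λρ.trace ≠ 0 → ∃ τ, IsSymExt (Λρ.trace⁻¹ • Λρ) τ) := by
  obtain ⟨σ, hσpos, -, hσtr, hσswap⟩ := hext
  set X : Fin m → Fin k → Fin k → Matrix (Fin dA × Fin dB × Fin dB) (Fin dA × Fin dB × Fin dB) ℂ :=
    fun i j l => (Amat i ⊗ₖ (Bmat i j ⊗ₖ Bmat i l)) * σ * (Amat i ⊗ₖ (Bmat i j ⊗ₖ Bmat i l))ᴴ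
    with hX
  set τ := ∑ i, ∑ j, ∑ l, X i j l with hτ
  have hpos : τ.PosSemidef :=
    Matrix.posSemidef_sum _ fun i _ => Matrix.posSemidef_sum _ fun j _ =>
      Matrix.posSemidef_sum _ fun l _ => hσpos.mul_mul_conjTranspose_same _
  have hswap (a b₁ b₂ a' b₁' b₂') :
      τ (a, b₁, b₂) (a', b₁', b₂') = τ (a, b₂, b₁) (a', b₂', b₁') := by
    simp only [hτ, Matrix.sum_apply]
    refine Finset.sum_congr rfl fun i _ => ?_
    rw [Finset.sum_comm]
    exact Finset.sum_congr rfl fun l _ => Finset.sum_congr rfl fun j _ =>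
      swap_kronecker_conj _ _ _ σ hσswap a b₁ b₂ a' b₁' b₂'
  have hσρ : traceThird σ = ρ := by
    ext ⟨a, b⟩ ⟨a', b'⟩
    exact hσtr a a' b b'
  have htrace : traceThird τ = Λρ := by
    simp only [hτ, hX, traceThird_sum, hΛρ, sum_traceThird_kronecker_conj _ _ _ (hB _), hσρ]
  have hentry (a a' b b') : ∑ c, τ (a, b, c) (a', b', c) = Λρ (a, b) (a', b') := by
    rw [← htrace]
    rfl
  have htr : τ.trace = Λρ.trace := by rw [← htrace, trace_traceThird]
  refine ⟨⟨τ, hpos, hswap, hentry⟩, fun hne => ⟨Λρ.trace⁻¹ • τ, ?_, ?_, ?_, ?_⟩⟩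
  · exact hpos.smul (inv_nonneg.2 (htr ▸ hpos.trace_nonneg))
  · rw [Matrix.trace_smul, htr, smul_eq_mul, inv_mul_cancel₀ hne]
  · intro a a' b b'
    simp only [Matrix.smul_apply, ← Finset.smul_sum, hentry]
  · intro a b₁ b₂ a' b₁' b₂'
    simp only [Matrix.smul_apply, hswap a b₁ b₂]
end
end

section
/- If a bipartite state ρ on A⊗B (dimensions dA, dB) admits a symmetric extension of rank one (a pure symmetric extension), then ρ satisfies the spectrum condition: the multiset of nonzero eigenvalues of ρ, counted with multiplicity, equals the multiset of nonzero eigenvalues of its reduced state ρ_B. -/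
open Matrix Kronecker ComplexOrder

noncomputable section

/-- A matrix of rank one over a field is an outer product of two vectors. -/
theorem Matrix.exists_eq_vecMulVec_of_rank_eq_one {K m n : Type*} [Field K] [Fintype m] [Fintype n]
    [DecidableEq n] (M : Matrix m n K) (hM : M.rank = 1) :
    ∃ (u : m → K) (v : n → K), M = vecMulVec u v := by
  rw [Matrix.rank, finrank_eq_one_iff'] at hM
  obtain ⟨u, -, hu⟩ := hM
  choose c hc using hu
  refine ⟨u, fun j => c ⟨M.mulVecLin (Pi.single j 1), LinearMap.mem_range_self _ _⟩, ?_⟩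
  ext i j
  have h := congrFun (congrArg Subtype.val
    (hc ⟨M.mulVecLin (Pi.single j 1), LinearMap.mem_range_self _ _⟩)) i
  simp only [Submodule.coe_smul, Pi.smul_apply, smul_eq_mul, mulVecLin_apply,
    mulVec_single_one, col_apply] at h
  rw [vecMulVec_apply, mul_comm, ← h]
  simp

/-- The products `M * N` and `N * M` of rectangular matrices have the same nonzero spectrum. -/
theorem nonzeroSpec_mul_comm {m n : Type*} [Fintype m] [DecidableEq m] [Fintype n] [DecidableEq n]
    (M : Matrix m n ℂ) (N : Matrix n m ℂ) :
    nonzeroSpec (M * N) = nonzeroSpec (N * M) := by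
  have h := congrArg (fun p => p.roots.filter (· ≠ 0)) (charpoly_mul_comm' M N)
  have hX (k : ℕ) (P : Polynomial ℂ) (hP : P.Monic) :
      (Polynomial.X ^ k * P).roots.filter (· ≠ 0) = P.roots.filter (· ≠ 0) := by
    rw [Polynomial.roots_mul ((Polynomial.monic_X_pow k).mul hP).ne_zero, Polynomial.roots_X_pow,
      Multiset.filter_add, Multiset.filter_nsmul]
    simp
  simpa only [nonzeroSpec, hX _ _ (charpoly_monic _)] using h

theorem nonzeroSpec_transpose {n : Type*} [Fintype n] [DecidableEq n] (M : Matrix n n ℂ) :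
    nonzeroSpec Mᵀ = nonzeroSpec M := by
  rw [nonzeroSpec, charpoly_transpose, nonzeroSpec]

/-- A state with a pure symmetric extension satisfies the spectrum condition. -/
theorem stmt_3 (dA dB : ℕ)
    (ρ : Matrix (Fin dA × Fin dB) (Fin dA × Fin dB) ℂ)
    (hρ : ρ.PosSemidef) (hρtr : ρ.trace = 1)
    (hpure : PureExt ρ) :
    nonzeroSpec ρ = nonzeroSpec (reduceB ρ) := by
  obtain ⟨σ, ⟨-, -, hpart, hswap⟩, hrank⟩ := hpure
  obtain ⟨u, v, rfl⟩ := σ.exists_eq_vecMulVec_of_rank_eq_one hrank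
  let U : Matrix (Fin dA × Fin dB) (Fin dB) ℂ := fun x c => u (x.1, x.2, c)
  let V : Matrix (Fin dB) (Fin dA × Fin dB) ℂ := fun c x => v (x.1, x.2, c)
  have hUV : ρ = U * V := by
    ext ⟨a, b⟩ ⟨a', b'⟩
    rw [← hpart, mul_apply]
    rfl
  have hVU : V * U = (reduceB ρ)ᵀ := by
    ext c c'
    simp only [mul_apply, transpose_apply, reduceB, ← hpart, Fintype.sum_prod_type]
    refine Finset.sum_congr rfl fun a _ => Finset.sum_congr rfl fun b _ => ?_
    rw [hswap, vecMulVec_apply, mul_comm]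
  rw [← nonzeroSpec_transpose (reduceB ρ), ← hVU, ← nonzeroSpec_mul_comm, ← hUV]
end
end

section
/- Let ρ be a two-qubit state (positive semidefinite trace-1 matrix indexed by Fin 2 × Fin 2) of rank 2. Then ρ admits a symmetric extension if and only if λ_max(ρ) ≤ λ_max(ρ_B), where λ_max denotes the largest eigenvalue of a Hermitian matrix and ρ_B is the reduced state of ρ on the second factor. -/
open Matrix Kronecker ComplexOrder

noncomputable section

/-- `ρ` has a positive semidefinite, swap-invariant extension, without any normalisation. -/
def HasSwapExt {A B : Type*} [Fintype B] (ρ : Matrix (A × B) (A × B) ℂ) : Prop :=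
  ∃ σ : Matrix (A × B × B) (A × B × B) ℂ, σ.PosSemidef ∧
    (∀ a a' b b', ∑ c, σ (a, b, c) (a', b', c) = ρ (a, b) (a', b')) ∧
    (∀ a b₁ b₂ a' b₁' b₂', σ (a, b₁, b₂) (a', b₁', b₂') = σ (a, b₂, b₁) (a', b₂', b₁'))

section General

variable {A B : Type*} [Fintype B]

theorem exists_isSymExt_iff_hasSwapExt [Fintype A] [DecidableEq A] [DecidableEq B]
    {ρ : Matrix (A × B) (A × B) ℂ} (hρ : ρ.trace = 1) :
    (∃ σ, IsSymExt ρ σ) ↔ HasSwapExt ρ := by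
  constructor
  · rintro ⟨σ, hσ, -, hp, hs⟩
    exact ⟨σ, hσ, hp, hs⟩
  · rintro ⟨σ, hσ, hp, hs⟩
    refine ⟨σ, hσ, ?_, hp, hs⟩
    rw [← hρ]
    simp only [Matrix.trace, Matrix.diag, Fintype.sum_prod_type, hp]

theorem HasSwapExt.add {ρ₁ ρ₂ : Matrix (A × B) (A × B) ℂ} (h₁ : HasSwapExt ρ₁)
    (h₂ : HasSwapExt ρ₂) : HasSwapExt (ρ₁ + ρ₂) := by
  obtain ⟨σ₁, hσ₁, hp₁, hs₁⟩ := h₁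
  obtain ⟨σ₂, hσ₂, hp₂, hs₂⟩ := h₂
  refine ⟨σ₁ + σ₂, hσ₁.add hσ₂, fun a a' b b' => ?_, fun a b c a' b' c' => ?_⟩
  · simp only [Matrix.add_apply, Finset.sum_add_distrib, hp₁, hp₂]
  · rw [Matrix.add_apply, Matrix.add_apply, hs₁, hs₂]

theorem HasSwapExt.of_symmetric_vector [Finite A] {ρ : Matrix (A × B) (A × B) ℂ} (T : A → B → B → ℂ)
    (hT : ∀ a b c, T a b c = T a c b)
    (hρ : ∀ a a' b b', ∑ c, T a b c * star (T a' b' c) = ρ (a, b) (a', b')) :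
    HasSwapExt ρ := by
  refine ⟨vecMulVec (fun x => T x.1 x.2.1 x.2.2) (star fun x => T x.1 x.2.1 x.2.2),
    posSemidef_vecMulVec_self_star _, fun a a' b b' => ?_, fun a b c a' b' c' => ?_⟩
  · simpa [vecMulVec_apply] using hρ a a' b b'
  · simp [vecMulVec_apply, hT a b c, hT a' b' c']

theorem sum_mul_star_col_of_mem_unitaryGroup [DecidableEq B] {W : Matrix B B ℂ}
    (hW : W ∈ unitaryGroup B ℂ)
    (j k : B) : ∑ c, W c j * star (W c k) = if j = k then 1 else 0 := by
  have h := congrFun (congrFun (mem_unitaryGroup_iff'.mp hW) k) j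
  simp only [Matrix.mul_apply, Matrix.star_apply, Matrix.one_apply] at h
  rw [Finset.sum_congr rfl fun c _ => mul_comm (W c j) _, h]
  simp [eq_comm]

theorem HasSwapExt.unitary_conj [Fintype A] [DecidableEq B] {ρ : Matrix (A × B) (A × B) ℂ}
    (h : HasSwapExt ρ)
    (U : Matrix A A ℂ) {W : Matrix B B ℂ} (hW : W ∈ unitaryGroup B ℂ) :
    HasSwapExt ((U ⊗ₖ W) * ρ * (U ⊗ₖ W)ᴴ) := by
  obtain ⟨σ, hσ, hp, hs⟩ := h
  refine ⟨(U ⊗ₖ (W ⊗ₖ W)) * σ * (U ⊗ₖ (W ⊗ₖ W))ᴴ, hσ.mul_mul_conjTranspose_same _,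
    fun a a' b b' => ?_, fun a b c a' b' c' => ?_⟩
  · have key : ∀ x y : A × B × B,
        ∑ c, U a x.1 * (W b x.2.1 * W c x.2.2) * σ x y * star (U a' y.1 * (W b' y.2.1 * W c y.2.2))
          = if x.2.2 = y.2.2 then U a x.1 * W b x.2.1 * σ x y * star (U a' y.1 * W b' y.2.1)
            else 0 := by
      intro x y
      rw [← mul_one (_ * star (U a' y.1 * W b' y.2.1)), ← mul_zero (_ * star (U a' y.1 * W b' y.2.1)),
        ← mul_ite, ← sum_mul_star_col_of_mem_unitaryGroup hW, Finset.mul_sum]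
      refine Finset.sum_congr rfl fun c _ => ?_
      simp only [star_mul']
      ring
    simp only [Matrix.mul_apply, conjTranspose_apply, kroneckerMap_apply, Finset.sum_mul]
    rw [Finset.sum_comm, Finset.sum_congr rfl fun y _ => Finset.sum_comm,
      Finset.sum_congr rfl fun y _ => Finset.sum_congr rfl fun x _ => key x y]
    simp only [← hp, Finset.mul_sum, Finset.sum_mul, Fintype.sum_prod_type, Finset.sum_ite_eq',
      Finset.mem_univ, if_true]
    refine Finset.sum_congr rfl fun l _ => Finset.sum_congr rfl fun m _ => ?_
    rw [Finset.sum_comm]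
    exact Finset.sum_congr rfl fun i _ => Finset.sum_comm
  · simp only [Matrix.mul_apply, conjTranspose_apply, kroneckerMap_apply, Finset.sum_mul,
      Fintype.sum_prod_type]
    refine Finset.sum_congr rfl fun i _ => ?_
    rw [Finset.sum_comm]
    refine Finset.sum_congr rfl fun j _ => Finset.sum_congr rfl fun k _ =>
      Finset.sum_congr rfl fun l _ => ?_
    rw [Finset.sum_comm]
    refine Finset.sum_congr rfl fun m _ => Finset.sum_congr rfl fun n _ => ?_
    rw [hs]
    simp only [star_mul']
    ring

theorem reduceB_kronecker_conj [Fintype A] [DecidableEq A] (ρ : Matrix (A × B) (A × B) ℂ)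
    {U : Matrix A A ℂ}
    (hU : U ∈ unitaryGroup A ℂ) (W : Matrix B B ℂ) :
    reduceB ((U ⊗ₖ W) * ρ * (U ⊗ₖ W)ᴴ) = W * reduceB ρ * Wᴴ := by
  ext b b'
  have key : ∀ x y : A × B,
      ∑ a, U a x.1 * W b x.2 * ρ x y * star (U a y.1 * W b' y.2)
        = if x.1 = y.1 then W b x.2 * ρ x y * star (W b' y.2) else 0 := by
    intro x y
    rw [← mul_one (_ * star (W b' y.2)), ← mul_zero (_ * star (W b' y.2)),
      ← mul_ite, ← sum_mul_star_col_of_mem_unitaryGroup hU, Finset.mul_sum]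
    refine Finset.sum_congr rfl fun c _ => ?_
    simp only [star_mul']
    ring
  simp only [reduceB, Matrix.mul_apply, conjTranspose_apply, kroneckerMap_apply, Finset.sum_mul]
  rw [Finset.sum_comm, Finset.sum_congr rfl fun y _ => Finset.sum_comm,
    Finset.sum_congr rfl fun y _ => Finset.sum_congr rfl fun x _ => key x y]
  simp only [Finset.mul_sum, Finset.sum_mul, Fintype.sum_prod_type_right, Finset.sum_ite_eq',
    Finset.mem_univ, if_true]
  refine Finset.sum_congr rfl fun m _ => ?_
  rw [Finset.sum_comm]

end General

theorem lamMax_unitary_conj {n : Type*} [Fintype n] [DecidableEq n] (M : Matrix n n ℂ)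
    {U : Matrix n n ℂ} (hU : U ∈ unitaryGroup n ℂ) : lamMax (U * M * Uᴴ) = lamMax M := by
  have h : spectrum ℂ (U * M * Uᴴ) = spectrum ℂ M := by
    have := Unitary.spectrum_star_right_conjugate (R := ℂ) (a := M) (U := ⟨U, hU⟩)
    simpa [star_eq_conjTranspose] using this
  rw [lamMax, h, lamMax]

theorem isGreatest_spectrum_fin_two {M : Matrix (Fin 2) (Fin 2) ℂ} (hM : M.IsHermitian)
    (htr : M.trace = 1) :
    4 * M.det.re ≤ 1 ∧
    IsGreatest {x : ℝ | (x : ℂ) ∈ spectrum ℂ M} ((1 + √(1 - 4 * M.det.re)) / 2) := by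
  have h01 : M 0 1 = star (M 1 0) := (hM.apply 0 1).symm
  have h0 : (M 0 0).im = 0 := by
    have := congrArg Complex.im (hM.apply 0 0); simp at this; linarith
  have h1 : (M 1 1).im = 0 := by
    have := congrArg Complex.im (hM.apply 1 1); simp at this; linarith
  have ht : (M 0 0).re + (M 1 1).re = 1 := by
    have := congrArg Complex.re htr; simpa [Matrix.trace_fin_two] using this
  have hre : M.det.re = (M 0 0).re * (M 1 1).re - Complex.normSq (M 1 0) := by
    simp [Matrix.det_fin_two, h01, h0, Complex.normSq_apply]
  have him : M.det.im = 0 := by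
    simp [Matrix.det_fin_two, h01, h0, h1]; ring
  have hdet : M.det = (M.det.re : ℂ) := by
    apply Complex.ext <;> simp [him]
  have hle : 4 * M.det.re ≤ 1 := by
    have := Complex.normSq_nonneg (M 1 0)
    nlinarith [sq_nonneg ((M 0 0).re - (M 1 1).re)]
  have key : ∀ x : ℝ, (x : ℂ) ∈ spectrum ℂ M ↔ x ^ 2 - x + M.det.re = 0 := by
    intro x
    rw [Matrix.mem_spectrum_iff_isRoot_charpoly, Matrix.charpoly_fin_two, htr, hdet]
    simp only [Polynomial.IsRoot, Polynomial.eval_add, Polynomial.eval_sub, Polynomial.eval_pow,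
      Polynomial.eval_X, Polynomial.eval_mul, Polynomial.eval_C, one_mul]
    norm_cast
  have hsq := Real.sq_sqrt (show (0 : ℝ) ≤ 1 - 4 * M.det.re by linarith)
  have hs := Real.sqrt_nonneg (1 - 4 * M.det.re)
  refine ⟨hle, ?_, fun x hx => ?_⟩
  · simp only [Set.mem_ofPred_eq, key]
    nlinarith
  · simp only [Set.mem_ofPred_eq, key] at hx
    have : 2 * x - 1 ≤ √(1 - 4 * M.det.re) := Real.le_sqrt_of_sq_le (by nlinarith)
    linarith

theorem lamMax_fin_two {M : Matrix (Fin 2) (Fin 2) ℂ} (hM : M.IsHermitian)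
    (htr : M.trace = 1) : lamMax M = (1 + √(1 - 4 * M.det.re)) / 2 :=
  (isGreatest_spectrum_fin_two hM htr).2.csSup_eq

theorem lamMax_mul_conjTranspose {n : Type*} [Fintype n] [DecidableEq n]
    (C : Matrix n (Fin 2) ℂ) (htr : (C * Cᴴ).trace = 1) :
    lamMax (C * Cᴴ) = (1 + √(1 - 4 * (Cᴴ * C).det.re)) / 2 := by
  rw [Matrix.trace_mul_comm] at htr
  obtain ⟨-, hmem, hub⟩ :=
    isGreatest_spectrum_fin_two (isHermitian_conjTranspose_mul_self C) htr
  have hs := Real.sqrt_nonneg (1 - 4 * (Cᴴ * C).det.re)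
  have key : ∀ x : ℝ, x ≠ 0 →
      ((x : ℂ) ∈ spectrum ℂ (C * Cᴴ) ↔ (x : ℂ) ∈ spectrum ℂ (Cᴴ * C)) := by
    intro x hx
    have hx' : (x : ℂ) ≠ 0 := by exact_mod_cast hx
    have h := congrArg (Polynomial.eval (x : ℂ)) (Matrix.charpoly_mul_comm' C Cᴴ)
    simp only [Polynomial.eval_mul, Polynomial.eval_pow, Polynomial.eval_X] at h
    rw [Matrix.mem_spectrum_iff_isRoot_charpoly, Matrix.mem_spectrum_iff_isRoot_charpoly,
      Polynomial.IsRoot, Polynomial.IsRoot]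
    constructor <;> intro h0 <;> rw [h0] at h
    · simpa [hx'] using h.symm
    · simpa [hx'] using h
  refine IsGreatest.csSup_eq ⟨(key _ (by positivity)).mpr hmem, fun x hx => ?_⟩
  by_cases hx0 : x = 0
  · rw [hx0]; positivity
  · exact hub ((key x hx0).mp hx)

theorem lamMax_le_lamMax_reduceB_iff {A : Type*} [Fintype A] [DecidableEq A]
    (C : Matrix (A × Fin 2) (Fin 2) ℂ) (htr : (C * Cᴴ).trace = 1) :
    lamMax (C * Cᴴ) ≤ lamMax (reduceB (C * Cᴴ)) ↔
      (reduceB (C * Cᴴ)).det.re ≤ (Cᴴ * C).det.re := by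
  have hH : (reduceB (C * Cᴴ)).IsHermitian := by
    ext b b'
    have h := isHermitian_mul_conjTranspose_self C
    simp only [conjTranspose_apply, reduceB, star_sum]
    exact Finset.sum_congr rfl fun a _ => h.apply _ _
  have htrB : (reduceB (C * Cᴴ)).trace = 1 := by
    rw [← htr]
    simp only [Matrix.trace, Matrix.diag, reduceB, Fintype.sum_prod_type]
    exact Finset.sum_comm
  rw [lamMax_mul_conjTranspose C htr, lamMax_fin_two hH htrB]
  have h := (isGreatest_spectrum_fin_two hH htrB).1
  rw [div_le_div_iff_of_pos_right two_pos, add_le_add_iff_left,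
    Real.sqrt_le_sqrt_iff (by linarith)]
  constructor <;> intro h <;> linarith

section TwoQubit

theorem exists_vecMulVec_add_of_rank_eq_two {n : Type*} [Fintype n] [DecidableEq n]
    {M : Matrix n n ℂ} (hM : M.PosSemidef) (hrank : M.rank = 2) :
    ∃ u v : n → ℂ, M = vecMulVec u (star u) + vecMulVec v (star v) := by
  have hcard := hM.1.rank_eq_card_non_zero_eigs.symm.trans hrank
  let e := Fintype.equivFinOfCardEq hcard
  let w : n → n → ℂ := fun k i => (√(hM.1.eigenvalues k) : ℂ) * hM.1.eigenvectorUnitary.1 i k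
  have hsum : M = ∑ k, vecMulVec (w k) (star (w k)) := by
    ext i j
    have h := congrFun (congrFun hM.1.spectral_theorem i) j
    rw [h, Unitary.conjStarAlgAut_apply, Matrix.mul_apply, Matrix.sum_apply]
    refine Finset.sum_congr rfl fun k _ => ?_
    have hsq : (√(hM.1.eigenvalues k) : ℂ) * (√(hM.1.eigenvalues k) : ℂ) =
        (hM.1.eigenvalues k : ℂ) := by
      exact_mod_cast Real.mul_self_sqrt (hM.eigenvalues_nonneg k)
    simp only [Matrix.mul_diagonal, vecMulVec_apply, w, Pi.star_apply, star_mul', star_apply,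
      Function.comp_apply, Complex.star_def, Complex.conj_ofReal, Complex.coe_algebraMap]
    erw [← hsq]
    simp
    ring
  refine ⟨w (e.symm 0), w (e.symm 1), ?_⟩
  have hz : ∀ k, hM.1.eigenvalues k = 0 → vecMulVec (w k) (star (w k)) = 0 := by
    intro k hk
    ext i j
    simp [vecMulVec_apply, w, hk]
  refine hsum.trans ?_
  rw [← Fintype.sum_subtype_add_sum_subtype (fun k => hM.1.eigenvalues k ≠ 0),
    Fintype.sum_eq_zero (f := fun k : {k // ¬ hM.1.eigenvalues k ≠ 0} => _)
      fun k => hz k (not_not.mp k.2), add_zero, ← e.symm.sum_comp, Fin.sum_univ_two]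

theorem exists_unit_linear_root (v w : ℂ) :
    ∃ c d : ℂ, c * star c + d * star d = 1 ∧ c * v + d * w = 0 := by
  by_cases h : v = 0 ∧ w = 0
  · exact ⟨1, 0, by simp, by simp [h.1]⟩
  · have hpos : 0 < Complex.normSq v + Complex.normSq w := by
      rcases not_and_or.mp h with h | h
      · exact add_pos_of_pos_of_nonneg (Complex.normSq_pos.mpr h) (Complex.normSq_nonneg w)
      · exact add_pos_of_nonneg_of_pos (Complex.normSq_nonneg v) (Complex.normSq_pos.mpr h)
    have hr : √(Complex.normSq v + Complex.normSq w) ≠ 0 := (Real.sqrt_pos.mpr hpos).ne'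
    have hr2 : (√(Complex.normSq v + Complex.normSq w) : ℂ) ^ 2 = v * star v + w * star w := by
      rw [Complex.star_def, Complex.mul_conj, Complex.mul_conj]
      exact_mod_cast Real.sq_sqrt hpos.le
    have hr' : (√(Complex.normSq v + Complex.normSq w) : ℂ) ≠ 0 := by exact_mod_cast hr
    refine ⟨w / √(Complex.normSq v + Complex.normSq w),
      -v / √(Complex.normSq v + Complex.normSq w), ?_, ?_⟩
    · simp only [star_div₀, star_neg, Complex.star_def, Complex.conj_ofReal] at hr2 ⊢
      field_simp
      rw [hr2]
      ring
    · field_simp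
      ring

theorem exists_unit_quadratic_root (a b c : ℂ) :
    ∃ p q : ℂ, p * star p + q * star q = 1 ∧ a * p ^ 2 + b * p * q + c * q ^ 2 = 0 := by
  by_cases ha : a = 0
  · exact ⟨1, 0, by simp, by simp [ha]⟩
  · obtain ⟨s, hs⟩ := IsAlgClosed.exists_eq_mul_self (discrim a b c)
    obtain ⟨t, ht⟩ := exists_quadratic_eq_zero ha ⟨s, hs⟩
    obtain ⟨p, q, hpq, h⟩ := exists_unit_linear_root 1 (-t)
    refine ⟨p, q, hpq, ?_⟩
    have hp : p = q * t := by linear_combination h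
    rw [hp]
    linear_combination q ^ 2 * ht

theorem exists_unit_row_relation {x : Fin 2 → Fin 2 → ℂ} (h : x 0 0 * x 1 1 - x 0 1 * x 1 0 = 0) :
    ∃ c d : ℂ, c * star c + d * star d = 1 ∧ ∀ b, c * x 0 b + d * x 1 b = 0 := by
  by_cases h0 : x 0 0 = 0 ∧ x 1 0 = 0
  · obtain ⟨c, d, hcd, hx⟩ := exists_unit_linear_root (x 0 1) (x 1 1)
    refine ⟨c, d, hcd, fun b => ?_⟩
    fin_cases b
    · simp [h0.1, h0.2]
    · exact hx
  · obtain ⟨c, d, hcd, hx⟩ := exists_unit_linear_root (x 0 0) (x 1 0)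
    refine ⟨c, d, hcd, fun b => ?_⟩
    fin_cases b
    · exact hx
    · change c * x 0 1 + d * x 1 1 = 0
      rcases not_and_or.mp h0 with h0 | h0
      · refine (mul_eq_zero.mp ?_).resolve_left h0
        linear_combination x 0 1 * hx + d * h
      · refine (mul_eq_zero.mp ?_).resolve_left h0
        linear_combination x 1 1 * hx - c * h

theorem unitary_of_unit_row {c d : ℂ} (h : c * star c + d * star d = 1) :
    !![star d, -star c; c, d] ∈ unitaryGroup (Fin 2) ℂ := by
  rw [mem_unitaryGroup_iff]
  ext i j
  fin_cases i <;> fin_cases j <;>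
    simp [Matrix.mul_apply, Matrix.star_apply] at h ⊢ <;> first | linear_combination h | ring

theorem exists_local_unitary_normal_form {ρ : Matrix (Fin 2 × Fin 2) (Fin 2 × Fin 2) ℂ}
    (hρ : ρ.PosSemidef) (hrank : ρ.rank = 2) :
    ∃ U ∈ unitaryGroup (Fin 2) ℂ, ∃ W ∈ unitaryGroup (Fin 2) ℂ, ∃ x y : Fin 2 × Fin 2 → ℂ,
      x (0, 1) = 0 ∧ x (1, 0) = 0 ∧ x (1, 1) = 0 ∧
      (U ⊗ₖ W) * ρ * (U ⊗ₖ W)ᴴ = vecMulVec x (star x) + vecMulVec y (star y) := by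
  obtain ⟨u, v, rfl⟩ := exists_vecMulVec_add_of_rank_eq_two hρ hrank
  obtain ⟨p, q, hpq, hroot⟩ := exists_unit_quadratic_root
    (u (0, 0) * u (1, 1) - u (0, 1) * u (1, 0))
    (u (0, 0) * v (1, 1) + v (0, 0) * u (1, 1) - u (0, 1) * v (1, 0) - v (0, 1) * u (1, 0))
    (v (0, 0) * v (1, 1) - v (0, 1) * v (1, 0))
  let x := p • u + q • v
  let y := (-star q) • u + star p • v
  have hxy : vecMulVec u (star u) + vecMulVec v (star v) =
      vecMulVec x (star x) + vecMulVec y (star y) := by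
    ext i j
    simp only [x, y, Matrix.add_apply, vecMulVec_apply, Pi.star_apply, Pi.add_apply, Pi.smul_apply,
      smul_eq_mul, star_add, star_mul', star_neg, star_star]
    linear_combination -(u i * star (u j) + v i * star (v j)) * hpq
  have hdet : x (0, 0) * x (1, 1) - x (0, 1) * x (1, 0) = 0 := by
    simp only [x, Pi.add_apply, Pi.smul_apply, smul_eq_mul]
    linear_combination hroot
  obtain ⟨c, d, hcd, hrow⟩ := exists_unit_row_relation (x := fun a b => x (a, b)) hdet
  obtain ⟨e, f, hef, hcol⟩ := exists_unit_row_relation (x := fun b a => x (a, b))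
    (by linear_combination hdet)
  refine ⟨_, unitary_of_unit_row hcd, _, unitary_of_unit_row hef,
    (!![star d, -star c; c, d] ⊗ₖ !![star f, -star e; e, f]) *ᵥ x,
    (!![star d, -star c; c, d] ⊗ₖ !![star f, -star e; e, f]) *ᵥ y, ?_, ?_, ?_, ?_⟩
  · simp [Matrix.mulVec, dotProduct, Fintype.sum_prod_type]
    linear_combination starRingEnd ℂ d * hcol 0 - starRingEnd ℂ c * hcol 1
  · simp [Matrix.mulVec, dotProduct, Fintype.sum_prod_type]
    linear_combination starRingEnd ℂ f * hrow 0 - starRingEnd ℂ e * hrow 1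
  · simp [Matrix.mulVec, dotProduct, Fintype.sum_prod_type]
    linear_combination e * hrow 0 + f * hrow 1
  · rw [hxy, Matrix.mul_add, Matrix.add_mul]
    simp only [Matrix.mul_vecMulVec, Matrix.vecMulVec_mul, Matrix.star_mulVec]

theorem hasSwapExt_vecMulVec_of_det_eq_zero {y : Fin 2 × Fin 2 → ℂ}
    (hy : y (0, 0) * y (1, 1) - y (0, 1) * y (1, 0) = 0) :
    HasSwapExt (vecMulVec y (star y)) := by
  obtain ⟨e, f, hef, hcol⟩ := exists_unit_row_relation (x := fun b a => y (a, b))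
    (by linear_combination hy)
  let α : Fin 2 → ℂ := fun a => y (a, 0) * star f - y (a, 1) * star e
  let β : Fin 2 → ℂ := ![f, -e]
  have hβ : ∑ c, β c * star (β c) = 1 := by
    simp only [β, Fin.sum_univ_two, cons_val_zero, cons_val_one, star_neg]
    linear_combination hef
  have hprod : ∀ a b, α a * β b = y (a, b) := by
    intro a b
    fin_cases b
    · change (y (a, 0) * star f - y (a, 1) * star e) * f = y (a, 0)
      linear_combination y (a, 0) * hef - star e * hcol a
    · change (y (a, 0) * star f - y (a, 1) * star e) * -e = y (a, 1)
      linear_combination y (a, 1) * hef - star f * hcol a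
  refine .of_symmetric_vector (fun a b c => α a * β b * β c) (fun a b c => by ring)
    fun a a' b b' => ?_
  simp only [vecMulVec_apply, Pi.star_apply, ← hprod]
  rw [← mul_one (_ * star _), ← hβ, Finset.mul_sum]
  refine Finset.sum_congr rfl fun c _ => ?_
  simp only [star_mul']
  ring

theorem hasSwapExt_of_normSq_le {x y : Fin 2 × Fin 2 → ℂ} (h01 : x (0, 1) = 0)
    (h10 : x (1, 0) = 0) (h11 : x (1, 1) = 0)
    (h : Complex.normSq (y (0, 0) * y (1, 1) - y (0, 1) * y (1, 0)) ≤
      Complex.normSq (x (0, 0)) * Complex.normSq (y (1, 0))) :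
    HasSwapExt (vecMulVec x (star x) + vecMulVec y (star y)) := by
  by_cases hy : y (1, 0) = 0
  · refine .add (hasSwapExt_vecMulVec_of_det_eq_zero (by simp [h01, h11]))
      (hasSwapExt_vecMulVec_of_det_eq_zero (Complex.normSq_eq_zero.mp ?_))
    refine le_antisymm (h.trans_eq ?_) (Complex.normSq_nonneg _)
    rw [hy, map_zero, mul_zero]
  · obtain ⟨c, d, hcd, hlin⟩ := exists_unit_linear_root (y (1, 1)) (-y (1, 0))
    have hc : c ≠ 0 := by
      rintro rfl
      have hd : d = 0 := by simpa [hy] using hlin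
      simp [hd] at hcd
    have hc' : starRingEnd ℂ c ≠ 0 := (map_ne_zero _).mpr hc
    let s : ℂ := (y (0, 1) * c - y (0, 0) * d) / starRingEnd ℂ c
    have hs : Complex.normSq s ≤ Complex.normSq (x (0, 0)) := by
      have hmul : (y (0, 1) * c - y (0, 0) * d) * y (1, 0) =
          -(c * (y (0, 0) * y (1, 1) - y (0, 1) * y (1, 0))) := by
        linear_combination y (0, 0) * hlin
      have hn := congrArg Complex.normSq hmul
      rw [map_mul, Complex.normSq_neg, map_mul] at hn
      have hy0 := Complex.normSq_pos.mpr hy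
      have hc0 := Complex.normSq_pos.mpr hc
      rw [map_div₀, Complex.normSq_conj, div_le_iff₀ hc0]
      refine le_of_mul_le_mul_right ?_ hy0
      rw [hn]
      nlinarith
    let r : ℂ := √(Complex.normSq (x (0, 0)) - Complex.normSq s)
    have hr : r * starRingEnd ℂ r + s * starRingEnd ℂ s =
        x (0, 0) * starRingEnd ℂ (x (0, 0)) := by
      simp only [r, Complex.conj_ofReal, Complex.mul_conj]
      rw [← Complex.ofReal_mul, Real.mul_self_sqrt (sub_nonneg.mpr hs)]
      push_cast
      ring
    let z : ℂ → Fin 2 × Fin 2 → ℂ := fun t => Pi.single (0, 0) t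
    have hdecomp : vecMulVec x (star x) + vecMulVec y (star y) =
        vecMulVec (z r) (star (z r)) +
          (vecMulVec (z s) (star (z s)) + vecMulVec y (star y)) := by
      rw [← add_assoc, add_left_inj]
      ext ⟨a, b⟩ ⟨a', b'⟩
      fin_cases a <;> fin_cases b <;> fin_cases a' <;> fin_cases b' <;>
        simp [vecMulVec_apply, z, h01, h10, h11, hr]
    rw [hdecomp]
    refine .add (hasSwapExt_vecMulVec_of_det_eq_zero (by simp [z])) ?_
    refine .of_symmetric_vector
      (fun a b k => z s (a, b) * ![-star d, star c] k + y (a, b) * ![c, d] k)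
      (fun a b k => ?_) fun a a' b b' => ?_
    · have h0 : s * starRingEnd ℂ c + y (0, 0) * d = y (0, 1) * c := by
        linear_combination div_mul_cancel₀ (y (0, 1) * c - y (0, 0) * d) hc'
      have h1 : y (1, 0) * d = y (1, 1) * c := by linear_combination -hlin
      fin_cases a <;> fin_cases b <;> fin_cases k <;>
        simp [z, h0, h1]
    · simp only [Fin.sum_univ_two, cons_val_zero, cons_val_one, star_add, star_mul', star_neg,
        star_star, Matrix.add_apply, vecMulVec_apply, Pi.star_apply]
      linear_combination
        (z s (a, b) * star (z s (a', b')) + y (a, b) * star (y (a', b'))) * hcd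

theorem smul_eq_smul_of_gram {A B E : Type*} [Fintype B] [NormedAddCommGroup E]
    [InnerProductSpace ℂ E] {ρ : Matrix (A × B) (A × B) ℂ} {g : A → B → B → E}
    (hg : ∀ a a' b b', ∑ c, inner ℂ (g a b c) (g a' b' c) = ρ (a, b) (a', b'))
    {a a' : A} {b b' : B} {α β : ℂ}
    (h : star α * α * ρ (a, b) (a, b) - star α * β * ρ (a, b) (a', b')
      - star β * α * ρ (a', b') (a, b) + star β * β * ρ (a', b') (a', b') = 0) (c : B) :
    α • g a b c = β • g a' b' c := by
  have hsum : ∑ c, ‖α • g a b c - β • g a' b' c‖ ^ 2 = 0 := by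
    have : ((∑ c, ‖α • g a b c - β • g a' b' c‖ ^ 2 : ℝ) : ℂ) = 0 := by
      rw [← h, ← hg, ← hg, ← hg, ← hg]
      simp only [Finset.mul_sum, ← Finset.sum_sub_distrib, ← Finset.sum_add_distrib]
      push_cast
      refine Finset.sum_congr rfl fun c _ => ?_
      have hn := inner_self_eq_norm_sq_to_K (𝕜 := ℂ) (α • g a b c - β • g a' b' c)
      rw [← Complex.coe_algebraMap] 
      refine hn.symm.trans ?_
      simp only [inner_sub_left, inner_sub_right, inner_smul_left, inner_smul_right,
        Complex.star_def]
      ring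
    exact_mod_cast this
  have hc := (Finset.sum_eq_zero_iff_of_nonneg fun c _ => sq_nonneg _).mp hsum c (Finset.mem_univ c)
  exact sub_eq_zero.mp (norm_eq_zero.mp (pow_eq_zero_iff two_ne_zero |>.mp hc))

open scoped MatrixOrder Matrix.Norms.L2Operator in
theorem HasSwapExt.exists_gram {A B : Type*} [Fintype A] [DecidableEq A] [Fintype B]
    [DecidableEq B] {ρ : Matrix (A × B) (A × B) ℂ} (h : HasSwapExt ρ) :
    ∃ v : A → B → B → EuclideanSpace ℂ (A × B × B),
      (∀ a a' b b', ∑ c, inner ℂ (v a b c) (v a' b' c) = ρ (a, b) (a', b')) ∧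
      (∀ a a' b b', ∑ c, inner ℂ (v a c b) (v a' c b') = ρ (a, b) (a', b')) := by
  obtain ⟨σ, hσ, hp, hs⟩ := h
  obtain ⟨M, rfl⟩ := CStarAlgebra.nonneg_iff_eq_star_mul_self.mp hσ.nonneg
  have hv : ∀ i j, inner ℂ (WithLp.toLp 2 fun k => M k i : EuclideanSpace ℂ (A × B × B))
      (WithLp.toLp 2 fun k => M k j) = (star M * M) i j := by
    intro i j
    simp only [PiLp.inner_apply, RCLike.inner_apply, Matrix.mul_apply, star_apply]
    exact Finset.sum_congr rfl fun k _ => mul_comm _ _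
  refine ⟨fun a b c => WithLp.toLp 2 fun k => M k (a, b, c), fun a a' b b' => ?_,
    fun a a' b b' => ?_⟩
  · simp only [hv, hp]
  · simp only [hv, ← hp]
    exact Finset.sum_congr rfl fun c _ => hs _ _ _ _ _ _

theorem HasSwapExt.normSq_le {x y : Fin 2 × Fin 2 → ℂ} (h01 : x (0, 1) = 0)
    (h10 : x (1, 0) = 0) (h11 : x (1, 1) = 0)
    (h : HasSwapExt (vecMulVec x (star x) + vecMulVec y (star y))) :
    Complex.normSq (y (0, 0) * y (1, 1) - y (0, 1) * y (1, 0)) ≤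
      Complex.normSq (x (0, 0)) * Complex.normSq (y (1, 0)) := by
  obtain ⟨v, hv, hw⟩ := h.exists_gram
  have hx : ∀ a b, (a, b) ≠ ((0, 0) : Fin 2 × Fin 2) → x (a, b) = 0 := by
    intro a b hab
    fin_cases a <;> fin_cases b <;> simp_all
  have hnull : ∀ {i j : Fin 2 × Fin 2}, i ≠ (0, 0) → j ≠ (0, 0) →
      star (star (y j)) * star (y j) * (vecMulVec x (star x) + vecMulVec y (star y)) i i
      - star (star (y j)) * star (y i) * (vecMulVec x (star x) + vecMulVec y (star y)) i j
      - star (star (y i)) * star (y j) * (vecMulVec x (star x) + vecMulVec y (star y)) j i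
      + star (star (y i)) * star (y i) * (vecMulVec x (star x) + vecMulVec y (star y)) j j
        = 0 := by
    intro i j hi hj
    simp only [Matrix.add_apply, vecMulVec_apply, Pi.star_apply, hx _ _ hi, hx _ _ hj, star_star]
    ring
  have relv : ∀ {a b a' b'}, (a, b) ≠ ((0, 0) : Fin 2 × Fin 2) →
      (a', b') ≠ ((0, 0) : Fin 2 × Fin 2) → ∀ c,
      star (y (a', b')) • v a b c = star (y (a, b)) • v a' b' c := fun hi hj =>
    smul_eq_smul_of_gram hv (hnull hi hj)
  have relw : ∀ {a b a' b'}, (a, b) ≠ ((0, 0) : Fin 2 × Fin 2) →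
      (a', b') ≠ ((0, 0) : Fin 2 × Fin 2) → ∀ c,
      star (y (a', b')) • v a c b = star (y (a, b)) • v a' c b' := fun hi hj =>
    smul_eq_smul_of_gram (g := fun a b c => v a c b) hw (hnull hi hj)
  have r1 := relv (a := 1) (b := 0) (a' := 1) (b' := 1) (by simp) (by simp)
  have r2 := relw (a := 1) (b := 0) (a' := 1) (b' := 1) (by simp) (by simp)
  by_cases hy : y (1, 0) = 0
  · by_cases hy1 : y (1, 1) = 0
    · simp [hy, hy1]
    · have hy1' : star (y (1, 1)) ≠ 0 := star_ne_zero.mpr hy1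
      have v10 : ∀ c, v 1 0 c = 0 := fun c => by
        have := r1 c
        rw [hy, star_zero, zero_smul] at this
        exact (smul_eq_zero.mp this).resolve_left hy1'
      have v110 : v 1 1 0 = 0 := by
        have := r2 1
        rw [hy, star_zero, zero_smul] at this
        exact (smul_eq_zero.mp this).resolve_left hy1'
      have v001 : v 0 0 1 = 0 := by
        have := relw (a := 0) (b := 1) (a' := 1) (b' := 1) (by simp) (by simp) 0
        rw [v10, smul_zero] at this
        exact (smul_eq_zero.mp this).resolve_left hy1'
      have h0 := hv 0 1 0 1
      rw [Fin.sum_univ_two, v110, v001, inner_zero_left, inner_zero_right] at h0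
      have hy0 : y (0, 0) = 0 := by
        simpa [vecMulVec_apply, h11, hy1] using h0
      simp [hy, hy0]
  · have hz : star (y (1, 0)) ≠ 0 := star_ne_zero.mpr hy
    let φ := (star (y (1, 0)) ^ 2)⁻¹ • v 1 0 0
    have solve : ∀ {u : EuclideanSpace ℂ (Fin 2 × Fin 2 × Fin 2)} {t : ℂ},
        star (y (1, 0)) • u = (star (y (1, 0)) * t) • φ → u = t • φ := by
      intro u t hu
      rw [mul_smul] at hu
      exact smul_right_injective _ hz hu
    have v100 : v 1 0 0 = star (y (1, 0)) ^ 2 • φ := by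
      rw [smul_inv_smul₀ (pow_ne_zero 2 hz)]
    have v110 : v 1 1 0 = (star (y (1, 0)) * star (y (1, 1))) • φ := solve <| by
      rw [← r1 0, v100, smul_smul]; congr 1; ring
    have v101 : v 1 0 1 = (star (y (1, 0)) * star (y (1, 1))) • φ := solve <| by
      rw [← r2 0, v100, smul_smul]; congr 1; ring
    have v001 : v 0 0 1 = (star (y (0, 1)) * star (y (1, 0))) • φ := solve <| by
      rw [relw (a := 0) (b := 1) (a' := 1) (b' := 0) (by simp) (by simp) 0, v100, smul_smul]
      congr 1; ring
    have hn : ∀ w : EuclideanSpace ℂ (Fin 2 × Fin 2 × Fin 2),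
        inner ℂ w w = ((‖w‖ ^ 2 : ℝ) : ℂ) := fun w => by
      rw [inner_self_eq_norm_sq_to_K]; norm_cast
    have h1010 := hv 1 1 0 0
    have h0010 := hv 0 1 0 0
    have h0000 := hv 0 0 0 0
    rw [Fin.sum_univ_two] at h1010 h0010 h0000
    simp only [v100, v101, v001, inner_smul_left, inner_smul_right] at h1010 h0010 h0000
    simp only [hn, Matrix.add_apply, vecMulVec_apply, Pi.star_apply, h10, zero_add, star_zero,
      mul_zero, Complex.star_def, map_mul, map_pow, Complex.conj_conj] at h1010 h0010 h0000
    have hG : Complex.normSq (inner ℂ (v 0 0 0) φ) ≤ ‖v 0 0 0‖ ^ 2 * ‖φ‖ ^ 2 := by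
      rw [Complex.normSq_eq_norm_sq, ← mul_pow]
      exact pow_le_pow_left₀ (norm_nonneg _) (norm_inner_le_norm _ _) 2
    generalize ‖φ‖ ^ 2 = F at h1010 h0010 h0000 hG
    generalize ‖v 0 0 0‖ ^ 2 = V at h0000 hG
    generalize inner ℂ (v 0 0 0) φ = G at h0010 hG
    have hm := Complex.normSq_pos.mpr hy
    have hm₁ := Complex.normSq_nonneg (y (1, 1))
    have hF : F * (Complex.normSq (y (1, 0)) + Complex.normSq (y (1, 1))) = 1 := by
      refine mul_left_cancel₀ hm.ne' ?_
      have : (Complex.normSq (y (1, 0)) : ℂ) *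
          (F * (Complex.normSq (y (1, 0)) + Complex.normSq (y (1, 1)))) =
            Complex.normSq (y (1, 0)) * 1 := by
        simp only [← Complex.mul_conj]
        linear_combination h1010
      exact_mod_cast this
    have hV : V + Complex.normSq (y (0, 1) * y (1, 0)) * F =
        Complex.normSq (x (0, 0)) + Complex.normSq (y (0, 0)) := by
      have : (V + Complex.normSq (y (0, 1) * y (1, 0)) * F : ℂ) =
          Complex.normSq (x (0, 0)) + Complex.normSq (y (0, 0)) := by
        simp only [← Complex.mul_conj]
        simp only [map_mul]
        linear_combination h0000
      exact_mod_cast this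
    have hGe : starRingEnd ℂ (y (1, 0)) * G =
        y (0, 0) - y (0, 1) * y (1, 0) * starRingEnd ℂ (y (1, 1)) * F := by
      refine mul_left_cancel₀ hz ?_
      rw [Complex.star_def]
      linear_combination h0010
    have hdet := congrArg Complex.normSq hGe
    rw [map_mul, Complex.normSq_conj, Complex.normSq_sub, map_mul, map_mul, Complex.normSq_conj,
      Complex.normSq_ofReal] at hdet
    have hR : (y (0, 0) * starRingEnd ℂ (y (0, 1) * y (1, 0) * starRingEnd ℂ (y (1, 1)) * F)).re =
        F * (y (0, 0) * y (1, 1) * starRingEnd ℂ (y (0, 1) * y (1, 0))).re := by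
      rw [← Complex.re_ofReal_mul]
      congr 1
      simp only [map_mul, Complex.conj_conj, Complex.conj_ofReal]
      ring
    rw [hR] at hdet
    rw [Complex.normSq_sub, map_mul]
    generalize (y (0, 0) * y (1, 1) * starRingEnd ℂ (y (0, 1) * y (1, 0))).re = R at hdet ⊢
    generalize Complex.normSq (y (0, 1) * y (1, 0)) = b at hdet hV ⊢
    generalize Complex.normSq (y (1, 0)) = m₀ at hdet hF hm ⊢
    generalize Complex.normSq (y (1, 1)) = m₁ at hdet hF hm₁ ⊢
    generalize Complex.normSq (y (0, 0)) = t at hdet hV ⊢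
    generalize Complex.normSq (x (0, 0)) = p at hV ⊢
    have hmul := mul_le_mul_of_nonneg_left hG (mul_nonneg hm.le (add_nonneg hm.le hm₁))
    linear_combination hmul - (m₀ + m₁) * hdet + m₀ * hV
      - (b + b * m₁ * F - 2 * R - m₀ * V) * hF

theorem hasSwapExt_iff_normSq_le {x y : Fin 2 × Fin 2 → ℂ} (h01 : x (0, 1) = 0)
    (h10 : x (1, 0) = 0) (h11 : x (1, 1) = 0) :
    HasSwapExt (vecMulVec x (star x) + vecMulVec y (star y)) ↔
    Complex.normSq (y (0, 0) * y (1, 1) - y (0, 1) * y (1, 0)) ≤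
      Complex.normSq (x (0, 0)) * Complex.normSq (y (1, 0)) :=
  ⟨HasSwapExt.normSq_le h01 h10 h11, hasSwapExt_of_normSq_le h01 h10 h11⟩

theorem hasSwapExt_iff_lamMax_le {x y : Fin 2 × Fin 2 → ℂ} (h01 : x (0, 1) = 0)
    (h10 : x (1, 0) = 0) (h11 : x (1, 1) = 0)
    (htr : (vecMulVec x (star x) + vecMulVec y (star y)).trace = 1) :
    HasSwapExt (vecMulVec x (star x) + vecMulVec y (star y)) ↔
      lamMax (vecMulVec x (star x) + vecMulVec y (star y)) ≤
        lamMax (reduceB (vecMulVec x (star x) + vecMulVec y (star y))) := by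
  rw [hasSwapExt_iff_normSq_le h01 h10 h11]
  let C : Matrix (Fin 2 × Fin 2) (Fin 2) ℂ := of fun i => ![x i, y i]
  have hC : vecMulVec x (star x) + vecMulVec y (star y) = C * Cᴴ := by
    ext i j
    simp [C, Matrix.mul_apply, vecMulVec_apply]
  rw [hC] at htr ⊢
  rw [lamMax_le_lamMax_reduceB_iff C htr]
  have hdet : (reduceB (C * Cᴴ)).det + Complex.normSq (x (0, 0)) * Complex.normSq (y (1, 0)) =
      (Cᴴ * C).det + Complex.normSq (y (0, 0) * y (1, 1) - y (0, 1) * y (1, 0)) := by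
    simp [C, Matrix.det_fin_two, reduceB, Matrix.mul_apply, Fintype.sum_prod_type, h01, h10, h11,
      ← Complex.mul_conj]
    ring
  have hre := congrArg Complex.re hdet
  rw [Complex.add_re, Complex.add_re, ← Complex.ofReal_mul, Complex.ofReal_re,
    Complex.ofReal_re] at hre
  constructor <;> intro h <;> linarith

end TwoQubit

/-- A rank-2 two-qubit state has a symmetric extension iff `λmax(ρ) ≤ λmax(ρ_B)`. -/
theorem stmt_10
    (ρ : Matrix (Fin 2 × Fin 2) (Fin 2 × Fin 2) ℂ)
    (hρ : ρ.PosSemidef) (hρtr : ρ.trace = 1) (hrank : ρ.rank = 2) :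
    (∃ σ, IsSymExt ρ σ) ↔ lamMax ρ ≤ lamMax (reduceB ρ) := by
  obtain ⟨U, hU, W, hW, x, y, h01, h10, h11, hUW⟩ := exists_local_unitary_normal_form hρ hrank
  have hK := kronecker_mem_unitary hU hW
  have hinv : (star U ⊗ₖ star W) * ((U ⊗ₖ W) * ρ * (U ⊗ₖ W)ᴴ) * (star U ⊗ₖ star W)ᴴ = ρ := by
    have h1 : (star U ⊗ₖ star W) * (U ⊗ₖ W) = 1 := by
      rw [← mul_kronecker_mul, mem_unitaryGroup_iff'.mp hU, mem_unitaryGroup_iff'.mp hW,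
        one_kronecker_one]
    calc _ = ((star U ⊗ₖ star W) * (U ⊗ₖ W)) * ρ * ((star U ⊗ₖ star W) * (U ⊗ₖ W))ᴴ := by
          simp only [conjTranspose_mul, Matrix.mul_assoc]
      _ = ρ := by rw [h1, conjTranspose_one, Matrix.one_mul, Matrix.mul_one]
  have htr : ((U ⊗ₖ W) * ρ * (U ⊗ₖ W)ᴴ).trace = 1 := by
    rw [Matrix.trace_mul_comm, ← Matrix.mul_assoc, ← star_eq_conjTranspose,
      mem_unitaryGroup_iff'.mp hK, Matrix.one_mul, hρtr]
  have hext : HasSwapExt ρ ↔ HasSwapExt ((U ⊗ₖ W) * ρ * (U ⊗ₖ W)ᴴ) :=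
    ⟨fun h => h.unitary_conj U hW, fun h => hinv ▸ h.unitary_conj (star U) (Unitary.star_mem hW)⟩
  rw [exists_isSymExt_iff_hasSwapExt hρtr, hext, ← lamMax_unitary_conj ρ hK,
    ← lamMax_unitary_conj (reduceB ρ) hW, ← reduceB_kronecker_conj ρ hU W]
  rw [hUW] at htr ⊢
  exact hasSwapExt_iff_lamMax_le h01 h10 h11 htr
end
end

section
/- Let ρ be a bipartite state on A⊗B where B is a qubit (dB = 2) and A has arbitrary finite dimension dA, and suppose ρ has rank 2. If ρ admits a symmetric extension, then λ_max(ρ) ≤ λ_max(ρ_B), where λ_max denotes the largest eigenvalue. Equivalently, no dA×2 state of rank 2 with λ_max(ρ_B) < λ_max(ρ) can have a symmetric extension. -/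
open Matrix Kronecker ComplexOrder

noncomputable section

open ComplexConjugate

theorem norm_sq_add_re_nonneg (x y z m n k : ℂ) (h1 : y ^ 2 = x * z)
    (h2 : m * n = y * (k + 2 * y)) :
    0 ≤ ‖x‖ ^ 2 + ‖z‖ ^ 2 + 2 * ‖y‖ ^ 2 + ‖m‖ ^ 2 + ‖n‖ ^ 2 + 2 * (k * conj y).re := by
  have h1' : ‖y‖ ^ 2 = ‖x‖ * ‖z‖ := by rw [← norm_pow, h1, norm_mul]
  have h2' : ‖m‖ * ‖n‖ = ‖y‖ * ‖k + 2 * y‖ := by rw [← norm_mul, h2, norm_mul]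
  have h3 : (k * conj y).re = ((k + 2 * y) * conj y).re - 2 * ‖y‖ ^ 2 := by
    rw [add_mul, mul_assoc 2 y, Complex.mul_conj', Complex.add_re]
    norm_cast
    simp
  have h4 : -(‖k + 2 * y‖ * ‖y‖) ≤ ((k + 2 * y) * conj y).re := by
    have := Complex.abs_re_le_norm ((k + 2 * y) * conj y)
    rw [norm_mul, RCLike.norm_conj] at this
    exact (abs_le.mp this).1
  nlinarith [sq_nonneg (‖x‖ - ‖z‖), sq_nonneg (‖m‖ - ‖n‖)]


/-- The polarized `2 × 2` minor, which equals twice the minor when `P = Q`. -/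
def polarMinor {m n : Type*} (P Q : m → n → ℂ) (a a' : m) (r r' : n) : ℂ :=
  P a r * Q a' r' + Q a r * P a' r' - P a r' * Q a' r - Q a r' * P a' r

theorem exists_mul_of_rank {m n : Type*} [Fintype m] [Fintype n] [DecidableEq n]
    {k : ℕ} (A : Matrix m n ℂ) (h : A.rank = k) :
    ∃ (P : Matrix m (Fin k) ℂ) (Q : Matrix (Fin k) n ℂ), A = P * Q := by
  let b := Module.finBasisOfFinrankEq ℂ (LinearMap.range A.mulVecLin) h
  have hmem (j : n) : A.col j ∈ LinearMap.range A.mulVecLin :=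
    ⟨Pi.single j 1, by simp⟩
  refine ⟨.of fun i l => (b l : m → ℂ) i, .of fun l j => b.repr ⟨A.col j, hmem j⟩ l, ?_⟩
  ext i j
  have := congrArg (fun v : LinearMap.range A.mulVecLin => (v : m → ℂ) i)
    (b.sum_repr ⟨A.col j, hmem j⟩)
  simp only [Submodule.coe_sum, Submodule.coe_smul, Finset.sum_apply, Pi.smul_apply,
    smul_eq_mul, Matrix.col_apply] at this
  simp only [Matrix.mul_apply, Matrix.of_apply, ← this, mul_comm]

section
variable {A R : Type*}

/-- The contribution of a pair of rows and a pair of columns to `tr (ρ_B ^ 2) - tr (ρ ^ 2)`, up to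
a constant, for the state with amplitude blocks `[[X, Y], [Y, Z]]`. -/
def purityExcess (X Y Z : A → R → ℂ) (a a' : A) (r r' : R) : ℝ :=
  ‖polarMinor X X a a' r r' / 2‖ ^ 2 + ‖polarMinor Z Z a a' r r' / 2‖ ^ 2
    + 2 * ‖polarMinor Y Y a a' r r' / 2‖ ^ 2 + ‖polarMinor X Y a a' r r'‖ ^ 2
    + ‖polarMinor Y Z a a' r r'‖ ^ 2
    + 2 * (polarMinor X Z a a' r r' * conj (polarMinor Y Y a a' r r' / 2)).re

/-- The summand of `tr (ρ_B ^ 2)` for the state with amplitude `t`. -/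
def reducedPurityTerm (t : A → Fin 2 → Fin 2 → R → ℂ) (a a' : A) (r r' : R) : ℂ :=
  ∑ b, ∑ b', ∑ c, ∑ c', t a b c r * conj (t a b' c r) * (t a' b' c' r' * conj (t a' b c' r'))

/-- The summand of `tr (ρ ^ 2)` for the state with amplitude `t`. -/
def purityTerm (t : A → Fin 2 → Fin 2 → R → ℂ) (a a' : A) (r r' : R) : ℂ :=
  ∑ b, ∑ b', ∑ c, ∑ c', t a b c r * conj (t a' b' c r) * (t a' b' c' r' * conj (t a b c' r'))

set_option maxHeartbeats 2000000 in
theorem sum_swap_purityTerm_diff (t : A → Fin 2 → Fin 2 → R → ℂ)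
    (ht : ∀ a r, t a 1 0 r = t a 0 1 r) (a a' : A) (r r' : R) :
    (reducedPurityTerm t a a' r r' - purityTerm t a a' r r')
    + (reducedPurityTerm t a' a r r' - purityTerm t a' a r r')
    + (reducedPurityTerm t a a' r' r - purityTerm t a a' r' r)
    + (reducedPurityTerm t a' a r' r - purityTerm t a' a r' r)
    = 2 * (purityExcess (fun a r => t a 0 0 r) (fun a r => t a 0 1 r) (fun a r => t a 1 1 r)
      a a' r r' : ℂ) := by
  have hre (z : ℂ) : ((z.re : ℝ) : ℂ) = (z + conj z) / 2 := by
    rw [Complex.add_conj]; push_cast; ring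
  simp only [reducedPurityTerm, purityTerm, purityExcess, polarMinor, Fin.sum_univ_two, ht,
    Complex.ofReal_add, Complex.ofReal_mul, Complex.ofReal_pow, ← Complex.mul_conj', hre,
    Complex.ofReal_ofNat, map_add, map_sub, map_mul, map_div₀, Complex.conj_conj, map_ofNat]
  ring

theorem purityExcess_nonneg (t : A → Fin 2 → Fin 2 → R → ℂ)
    (ht : ∀ a r, t a 1 0 r = t a 0 1 r)
    (P : A → Fin 2 → Fin 2 → ℂ) (Q : Fin 2 → Fin 2 → R → ℂ)
    (hPQ : ∀ a b c r, t a b c r = ∑ i, P a b i * Q i c r) (a a' : A) (r r' : R) :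
    0 ≤ purityExcess (fun a r => t a 0 0 r) (fun a r => t a 0 1 r) (fun a r => t a 1 1 r)
      a a' r r' := by
  have hY : (fun a r => t a 1 0 r) = fun a r => t a 0 1 r := funext₂ ht
  refine norm_sq_add_re_nonneg _ _ _ _ _ _ ?_ ?_
  · calc
      _ = polarMinor (fun a r => t a 0 1 r) (fun a r => t a 0 1 r) a a' r r' / 2 *
          (polarMinor (fun a r => t a 1 0 r) (fun a r => t a 1 0 r) a a' r r' / 2) := by
        rw [sq, hY]
      _ = _ := by
        simp only [polarMinor, hPQ, Fin.sum_univ_two]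
        ring
  · calc
      _ = polarMinor (fun a r => t a 0 1 r) (fun a r => t a 0 1 r) a a' r r' / 2 *
          (polarMinor (fun a r => t a 0 0 r) (fun a r => t a 1 1 r) a a' r r' +
            polarMinor (fun a r => t a 0 1 r) (fun a r => t a 1 0 r) a a' r r') := by
        simp only [polarMinor, hPQ, Fin.sum_univ_two]
        ring
      _ = _ := by rw [hY, mul_div_cancel₀ _ (two_ne_zero' ℂ)]

variable [Fintype A] [Fintype R]

theorem sum_purityTerm_re_le (t : A → Fin 2 → Fin 2 → R → ℂ)
    (ht : ∀ a r, t a 1 0 r = t a 0 1 r)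
    (P : A → Fin 2 → Fin 2 → ℂ) (Q : Fin 2 → Fin 2 → R → ℂ)
    (hPQ : ∀ a b c r, t a b c r = ∑ i, P a b i * Q i c r) :
    (∑ a, ∑ a', ∑ r, ∑ r', purityTerm t a a' r r').re ≤
      (∑ a, ∑ a', ∑ r, ∑ r', reducedPurityTerm t a a' r r').re := by
  set f : A → A → R → R → ℂ := fun a a' r r' =>
    reducedPurityTerm t a a' r r' - purityTerm t a a' r r' with hf
  have hA (g : A → A → R → R → ℂ) : ∑ a, ∑ a', ∑ r, ∑ r', g a' a r r'
      = ∑ a, ∑ a', ∑ r, ∑ r', g a a' r r' := Finset.sum_comm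
  have hR (g : A → A → R → R → ℂ) : ∑ a, ∑ a', ∑ r, ∑ r', g a a' r' r
      = ∑ a, ∑ a', ∑ r, ∑ r', g a a' r r' :=
    Finset.sum_congr rfl fun _ _ => Finset.sum_congr rfl fun _ _ => Finset.sum_comm
  have h4 : 4 * ∑ a, ∑ a', ∑ r, ∑ r', f a a' r r' =
      ∑ a, ∑ a', ∑ r, ∑ r', (f a a' r r' + f a' a r r' + f a a' r' r + f a' a r' r) := by
    simp only [Finset.sum_add_distrib]
    rw [hA f, hR f, hA fun a a' r r' => f a a' r' r, hR f]
    ring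
  simp only [hf, sum_swap_purityTerm_diff t ht] at h4
  have h5 := congrArg Complex.re h4
  have h6 : 0 ≤ ∑ a, ∑ a', ∑ r, ∑ r', 2 * purityExcess (fun a r => t a 0 0 r)
      (fun a r => t a 0 1 r) (fun a r => t a 1 1 r) a a' r r' :=
    Finset.sum_nonneg fun a _ => Finset.sum_nonneg fun a' _ => Finset.sum_nonneg fun r _ =>
      Finset.sum_nonneg fun r' _ => mul_nonneg zero_le_two
        (purityExcess_nonneg t ht P Q hPQ a a' r r')
  simp only [Finset.sum_sub_distrib, Complex.mul_re, Complex.re_ofNat, Complex.im_ofNat,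
    zero_mul, sub_zero, Complex.re_sum, Complex.ofReal_re, Complex.ofReal_im] at h5 h6 ⊢
  simp only [Complex.sub_re, Complex.re_sum] at h5
  linarith

theorem trace_sq_eq (t : A → Fin 2 → Fin 2 → R → ℂ) (ρ : Matrix (A × Fin 2) (A × Fin 2) ℂ)
    (h : ∀ a b a' b', ρ (a, b) (a', b') = ∑ c, ∑ r, t a b c r * conj (t a' b' c r)) :
    (ρ * ρ).trace = ∑ a, ∑ a', ∑ r, ∑ r', purityTerm t a a' r r' := by
  simp only [Matrix.trace, Matrix.diag, Matrix.mul_apply, Fintype.sum_prod_type, h, purityTerm,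
    Fin.sum_univ_two, Finset.sum_mul_sum, add_mul, mul_add, Finset.sum_add_distrib]

theorem trace_sq_reduceB_eq (t : A → Fin 2 → Fin 2 → R → ℂ)
    (ρ : Matrix (A × Fin 2) (A × Fin 2) ℂ)
    (h : ∀ a b a' b', ρ (a, b) (a', b') = ∑ c, ∑ r, t a b c r * conj (t a' b' c r)) :
    (reduceB ρ * reduceB ρ).trace = ∑ a, ∑ a', ∑ r, ∑ r', reducedPurityTerm t a a' r r' := by
  simp only [Matrix.trace, Matrix.diag, Matrix.mul_apply, reduceB, h, reducedPurityTerm,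
    Fin.sum_univ_two, Finset.sum_mul_sum, add_mul, mul_add, Finset.sum_add_distrib]

/-- A symmetrically extendible state has an amplitude that is symmetric in the two `B` factors: the
antisymmetric part of an extension can be replaced by a classically correlated one. -/
theorem exists_symmetric_amplitude (ρ : Matrix (A × Fin 2) (A × Fin 2) ℂ)
    (σ : Matrix (A × Fin 2 × Fin 2) (A × Fin 2 × Fin 2) ℂ)
    (hσ : σ.PosSemidef)
    (hm : ∀ a a' b b', ∑ c, σ (a, b, c) (a', b', c) = ρ (a, b) (a', b'))
    (hs : ∀ a b₁ b₂ a' b₁' b₂', σ (a, b₁, b₂) (a', b₁', b₂') = σ (a, b₂, b₁) (a', b₂', b₁')) :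
    ∃ (k : ℕ) (t : A → Fin 2 → Fin 2 → Fin k ⊕ Fin k ⊕ Fin k → ℂ),
      (∀ a r, t a 1 0 r = t a 0 1 r) ∧
      ∀ a b a' b', ρ (a, b) (a', b') = ∑ c, ∑ r, t a b c r * conj (t a' b' c r) := by
  obtain ⟨k, v, rfl⟩ := Matrix.posSemidef_iff_eq_sum_vecMulVec.mp hσ
  simp only [Matrix.sum_apply, Matrix.vecMulVec_apply, Pi.star_apply, RCLike.star_def] at hm hs
  let α (a : A) (r : Fin k) : ℂ := (v r (a, 0, 1) - v r (a, 1, 0)) / 2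
  refine ⟨k, fun a b c => Sum.elim (fun r => (v r (a, b, c) + v r (a, c, b)) / 2)
    (Sum.elim (fun r => if b = 0 ∧ c = 0 then α a r else 0)
      fun r => if b = 1 ∧ c = 1 then α a r else 0), ?_, ?_⟩
  · rintro a (r | r | r) <;> simp [add_comm]
  · intro a b a' b'
    rw [← hm]
    have h1 := hs a 0 1 a' 0 1
    have h2 := hs a 0 0 a' 0 1
    have h3 := hs a 0 1 a' 0 0
    have h4 := hs a 1 1 a' 0 1
    have h5 := hs a 0 1 a' 1 1
    have hsum (f g p q : Fin k → ℂ) (z : ℂ) (hpq : ∑ r, p r = ∑ r, q r)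
        (hfg : ∀ r, f r - g r = z * (p r - q r)) : ∑ r, f r = ∑ r, g r := by
      rw [← sub_eq_zero, ← Finset.sum_sub_distrib]
      simp only [hfg, ← Finset.mul_sum, Finset.sum_sub_distrib, hpq, sub_self, mul_zero]
    have h23 := congrArg₂ (· + ·) h3.symm h4
    have h25 := congrArg₂ (· + ·) h2.symm h5
    simp only [← Finset.sum_add_distrib] at h23 h25
    simp only [Fintype.sum_sum_type, Sum.elim_inl, Sum.elim_inr, Fin.sum_univ_two, α]
    fin_cases b <;> fin_cases b' <;> simp <;>
      simp only [← Finset.sum_add_distrib, map_ofNat]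
    · exact hsum _ _ _ _ (1 / 2) h1 fun r => by ring
    · exact hsum _ _ _ _ (1 / 2) h25 fun r => by ring
    · exact hsum _ _ _ _ (1 / 2) h23 fun r => by ring
    · exact hsum _ _ _ _ (-1 / 2) h1 fun r => by ring
end

section
variable {n : Type*} [Fintype n] [DecidableEq n]

theorem trace_mul_self_eq_sum_eigenvalues_sq {M : Matrix n n ℂ} (hM : M.IsHermitian) :
    (M * M).trace.re = ∑ i, hM.eigenvalues i ^ 2 := by
  have h : (M * M).trace = ∑ i, (hM.eigenvalues i : ℂ) ^ 2 := by
    conv_lhs => rw [hM.spectral_theorem, ← map_mul, Unitary.conjStarAlgAut_apply,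
      Matrix.trace_mul_cycle, Unitary.coe_star_mul_self, one_mul, Matrix.diagonal_mul_diagonal,
      Matrix.trace_diagonal]
    simp [sq]
  rw [h]
  norm_cast

theorem sum_eigenvalues_eq_one {M : Matrix n n ℂ} (hM : M.IsHermitian) (htr : M.trace = 1) :
    ∑ i, hM.eigenvalues i = 1 := by
  have := hM.trace_eq_sum_eigenvalues
  rw [htr] at this
  exact Complex.ofReal_injective (by simpa using this.symm)

theorem eigenvalues_le_lamMax {M : Matrix n n ℂ} (hM : M.IsHermitian) (i : n) :
    hM.eigenvalues i ≤ lamMax M := by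
  have hset : {x : ℝ | (x : ℂ) ∈ spectrum ℂ M} = Set.range hM.eigenvalues := by
    ext x
    simp [hM.spectrum_eq_image_range]
  rw [lamMax, hset]
  exact le_csSup (Set.finite_range _).bddAbove ⟨i, rfl⟩

theorem lamMax_le {M : Matrix n n ℂ} (hM : M.IsHermitian) {x : ℝ} (hx : 0 ≤ x)
    (h : ∀ i, hM.eigenvalues i ≤ x) : lamMax M ≤ x := by
  refine Real.sSup_le (fun y hy => ?_) hx
  rw [Set.mem_ofPred_eq, hM.spectrum_eq_image_range] at hy
  obtain ⟨_, ⟨i, rfl⟩, hi⟩ := hy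
  exact (Complex.ofReal_injective hi) ▸ h i

theorem trace_sq_eq_of_rank_two {M : Matrix n n ℂ} (hM : M.IsHermitian) (htr : M.trace = 1)
    (hrank : M.rank = 2) (i : n) (hi : hM.eigenvalues i ≠ 0) :
    (M * M).trace.re = hM.eigenvalues i ^ 2 + (1 - hM.eigenvalues i) ^ 2 := by
  have hcard : (Finset.univ.filter fun j => hM.eigenvalues j ≠ 0).card = 2 := by
    rw [← hrank, hM.rank_eq_card_non_zero_eigs, Fintype.card_subtype]
  obtain ⟨j, hij, hj⟩ : ∃ j, i ≠ j ∧
      Finset.univ.filter (fun j => hM.eigenvalues j ≠ 0) = {i, j} := by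
    have hmem : i ∈ Finset.univ.filter (fun j => hM.eigenvalues j ≠ 0) := by simpa using hi
    obtain ⟨x, y, hxy, h⟩ := Finset.card_eq_two.mp hcard
    rw [h] at hmem ⊢
    rcases Finset.mem_insert.mp hmem with rfl | hy
    · exact ⟨y, hxy, rfl⟩
    · rw [Finset.mem_singleton.mp hy]
      exact ⟨x, hxy.symm, Finset.pair_comm _ _⟩
  have hsub (f : ℝ → ℝ) (hf : f 0 = 0) :
      ∑ l, f (hM.eigenvalues l) = f (hM.eigenvalues i) + f (hM.eigenvalues j) := by
    rw [← Finset.sum_pair (f := fun l => f (hM.eigenvalues l)) hij, ← hj, Finset.sum_filter_of_ne]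
    intro l _ hl h0
    exact hl (by rw [h0, hf])
  have h1 := hsub id rfl
  simp only [id, sum_eigenvalues_eq_one hM htr] at h1
  rw [trace_mul_self_eq_sum_eigenvalues_sq hM, hsub (· ^ 2) (by norm_num), h1]
  ring

theorem lamMax_le_of_trace_sq_le {M : Matrix n n ℂ} {N : Matrix (Fin 2) (Fin 2) ℂ}
    (hM : M.IsHermitian) (hMtr : M.trace = 1) (hrank : M.rank = 2)
    (hN : N.IsHermitian) (hNtr : N.trace = 1)
    (h : (M * M).trace.re ≤ (N * N).trace.re) : lamMax M ≤ lamMax N := by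
  have hs := sum_eigenvalues_eq_one hN hNtr
  rw [trace_mul_self_eq_sum_eigenvalues_sq hN] at h
  have h0 := eigenvalues_le_lamMax hN 0
  have h1 := eigenvalues_le_lamMax hN 1
  rw [Fin.sum_univ_two] at hs h
  have hpos : 0 ≤ lamMax N := by linarith
  refine lamMax_le hM hpos fun i => ?_
  by_cases hi : hM.eigenvalues i = 0
  · rwa [hi]
  rw [trace_sq_eq_of_rank_two hM hMtr hrank i hi] at h
  by_contra! hlt
  have hprod := mul_pos (sub_pos.mpr (h0.trans_lt hlt)) (sub_pos.mpr (h1.trans_lt hlt))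
  have he := eq_sub_of_add_eq' hs
  rw [he] at hprod h
  nlinarith
end

/-- Necessity of the max-eigenvalue condition for rank-2 states on `dA × 2`. -/
theorem stmt_11 (dA : ℕ)
    (ρ : Matrix (Fin dA × Fin 2) (Fin dA × Fin 2) ℂ)
    (hρ : ρ.PosSemidef) (hρtr : ρ.trace = 1) (hrank : ρ.rank = 2)
    (hext : ∃ σ, IsSymExt ρ σ) :
    lamMax ρ ≤ lamMax (reduceB ρ) := by
  obtain ⟨σ, hσ, -, hm, hs⟩ := hext
  obtain ⟨k, t, ht, hρt⟩ := exists_symmetric_amplitude ρ σ hσ hm hs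
  let T : Matrix (Fin dA × Fin 2) (Fin 2 × (Fin k ⊕ Fin k ⊕ Fin k)) ℂ :=
    .of fun i j => t i.1 i.2 j.1 j.2
  have hT : ρ = T * Tᴴ := by
    ext ⟨a, b⟩ ⟨a', b'⟩
    simp [Matrix.mul_apply, Fintype.sum_prod_type, hρt, T]
  obtain ⟨P, Q, hPQ⟩ := exists_mul_of_rank T
    (by rw [← Matrix.rank_self_mul_conjTranspose, ← hT, hrank])
  have hle := sum_purityTerm_re_le t ht (fun a b => P (a, b)) (fun i c r => Q i (c, r))
    fun a b c r => by simpa [T, Matrix.mul_apply] using congrFun₂ hPQ (a, b) (c, r)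
  rw [← trace_sq_eq t ρ hρt, ← trace_sq_reduceB_eq t ρ hρt] at hle
  refine lamMax_le_of_trace_sq_le hρ.isHermitian hρtr hrank ?_ ?_ hle
  · ext b b'
    simp [reduceB, Matrix.conjTranspose_apply, ← hρ.isHermitian.apply (_, b) (_, b')]
  · rw [← hρtr, Matrix.trace, Matrix.trace, Fintype.sum_prod_type, Finset.sum_comm]
    rfl
end
end
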